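/- Let N ≥ 2. For every Borel set A ⊆ Δ_{N−1} with positive uniform measure U(A) > 0, there exists ρ_A > 0 such that for every starting point x ∈ Δ_{N−1} and every M ∈ ℕ, the first hitting time of A by the coagulation–fragmentation chain satisfies P_x(τ_A > (N−1)M) ≤ (1 − ρ_A)^M; in particular the return times to any set of positive uniform measure have at most geometric tails, uniformly in the starting point. -/

import Mathlib

open MeasureTheory Filter
open scoped ENNReal NNReal Topology

/-- The coagulation–fragmentation map `T_{i,j,u}` on `ℝ^N`: the `i`-th coordinate of the
output is `u (x_i + x_j)`, the `j`-th coordinate is `(1-u)(x_i + x_j)`, and all other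
coordinates are unchanged. -/
noncomputable def cfT (N : ℕ) (i j : Fin N) (u : ℝ) (x : Fin N → ℝ) : Fin N → ℝ :=
  Function.update (Function.update x i (u * (x i + x j))) j ((1 - u) * (x i + x j))

/-- The coagulation–fragmentation kernel on the simplex `Δ_{N-1}`, viewed as a
measure-valued map: `K(x, A) = (1/(N(N-1))) ∑_{(i,j) : i ≠ j} Leb{u ∈ [0,1] : T_{i,j,u}(x) ∈ A}`. -/
noncomputable def cfK (N : ℕ) (x : Fin N → ℝ) : Measure (Fin N → ℝ) :=
  ((N : ℝ≥0∞) * ((N : ℝ≥0∞) - 1))⁻¹ •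
    ∑ p ∈ Finset.univ.filter (fun p : Fin N × Fin N => p.1 ≠ p.2),
      (volume.restrict (Set.Icc (0 : ℝ) 1)).map (fun u => cfT N p.1 p.2 u x)

/-- The uniform distribution on the simplex `Δ_{N-1}`: the `(N-1)`-dimensional Hausdorff
measure restricted to `Δ_{N-1}` and normalized to be a probability measure. -/
noncomputable def uniformSimplex (N : ℕ) : Measure (Fin N → ℝ) :=
  (μH[(N : ℝ) - 1] (stdSimplex ℝ (Fin N)))⁻¹ •
    μH[(N : ℝ) - 1].restrict (stdSimplex ℝ (Fin N))

/-- Iterated action of a (measure-valued) Markov transition `κ` on an initial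
distribution: `evolve κ k μ = μ κ^k` is the time-`k` marginal of the chain with initial
distribution `μ` and transition kernel `κ`. -/
noncomputable def evolve {α : Type*} [MeasurableSpace α] (κ : α → Measure α) :
    ℕ → Measure α → Measure α
  | 0, μ => μ
  | k + 1, μ => (evolve κ k μ).bind κ

/-- `hitProb κ B m x` is the probability `P_x(τ_B ≤ m)` that the Markov chain with
transition kernel `κ` started at `x` hits the set `B` within the first `m` steps, where
`τ_B = inf{k ≥ 1 : X_k ∈ B}` is the first hitting time of `B`. It is defined through the
one-step (Markov) recursion
`P_x(τ_B ≤ m+1) = ∫ (1_B(y) + 1_{Bᶜ}(y) P_y(τ_B ≤ m)) κ(x, dy)`, `P_x(τ_B ≤ 0) = 0`. -/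
noncomputable def hitProb {α : Type*} [MeasurableSpace α] (κ : α → MeasureTheory.Measure α)
    (B : Set α) : ℕ → α → ℝ≥0∞
  | 0, _ => 0
  | m + 1, x =>
      ∫⁻ y, (B.indicator (fun _ => 1) y + Bᶜ.indicator (hitProb κ B m) y) ∂(κ x)


lemma measurable_cfT (N : ℕ) (i j : Fin N) :
    Measurable fun q : (Fin N → ℝ) × ℝ => cfT N i j q.2 q.1 := by
  unfold cfT
  exact Continuous.measurable (by fun_prop)

lemma lintegral_cfK (N : ℕ) (x : Fin N → ℝ) {f : (Fin N → ℝ) → ℝ≥0∞} (hf : Measurable f) :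
    ∫⁻ y, f y ∂(cfK N x) = ((N : ℝ≥0∞) * ((N : ℝ≥0∞) - 1))⁻¹ *
      ∑ p ∈ Finset.univ.filter (fun p : Fin N × Fin N => p.1 ≠ p.2),
        ∫⁻ u in Set.Icc (0 : ℝ) 1, f (cfT N p.1 p.2 u x) := by
  rw [cfK, lintegral_smul_measure, lintegral_finsetSum_measure, smul_eq_mul]
  congr 1
  refine Finset.sum_congr rfl fun p _ => ?_
  exact lintegral_map hf ((measurable_cfT N p.1 p.2).comp measurable_prodMk_left)

lemma measurable_lintegral_cfK (N : ℕ) {f : (Fin N → ℝ) → ℝ≥0∞} (hf : Measurable f) :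
    Measurable fun x => ∫⁻ y, f y ∂(cfK N x) := by
  simp_rw [lintegral_cfK N _ hf]
  refine Measurable.const_mul (Finset.measurable_sum _ fun p _ => ?_) _
  exact (hf.comp (measurable_cfT N p.1 p.2)).lintegral_prod_right'

lemma isProbabilityMeasure_cfK {N : ℕ} (hN : 2 ≤ N) (x : Fin N → ℝ) :
    IsProbabilityMeasure (cfK N x) := by
  constructor
  rw [← lintegral_one, lintegral_cfK N x measurable_const]
  have hcard : (Finset.univ.filter (fun p : Fin N × Fin N => p.1 ≠ p.2)).card = N * (N - 1) := by
    have h : Finset.univ.filter (fun p : Fin N × Fin N => p.1 ≠ p.2) =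
        (Finset.univ : Finset (Fin N)).offDiag := by ext; simp
    rw [h, Finset.offDiag_card, Finset.card_univ, Fintype.card_fin, Nat.mul_sub_one]
  have hcast : (N : ℝ≥0∞) * ((N : ℝ≥0∞) - 1) = ((N * (N - 1) : ℕ) : ℝ≥0∞) := by
    push_cast
    simp
  have hpos : N * (N - 1) ≠ 0 := Nat.mul_ne_zero (by omega) (by omega)
  simp only [lintegral_const, MeasurableSet.univ, Measure.restrict_apply, Set.univ_inter,
    Real.volume_Icc, sub_zero, ENNReal.ofReal_one, mul_one, Finset.sum_const, nsmul_eq_mul]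
  rw [hcard, hcast]
  exact ENNReal.inv_mul_cancel (by exact_mod_cast hpos) (ENNReal.natCast_ne_top _)

lemma cfT_mem_stdSimplex {N : ℕ} {i j : Fin N} (hij : i ≠ j) {u : ℝ} (hu : u ∈ Set.Icc (0 : ℝ) 1)
    {x : Fin N → ℝ} (hx : x ∈ stdSimplex ℝ (Fin N)) : cfT N i j u x ∈ stdSimplex ℝ (Fin N) := by
  obtain ⟨h0, h1⟩ := hx
  have hs : 0 ≤ x i + x j := add_nonneg (h0 i) (h0 j)
  refine ⟨fun k => ?_, ?_⟩
  · simp only [cfT, Function.update_apply]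
    split_ifs
    · exact mul_nonneg (by linarith [hu.2]) hs
    · exact mul_nonneg hu.1 hs
    · exact h0 k
  · have hcoord : ∀ k, cfT N i j u x k = x k + (if k = i then u * (x i + x j) - x i else 0) +
        (if k = j then (1 - u) * (x i + x j) - x j else 0) := by
      intro k
      simp only [cfT, Function.update_apply]
      by_cases hj : k = j
      · subst hj
        simp [hij.symm]
      · by_cases hi : k = i
        · subst hi
          simp [hj]
        · simp [hi, hj]
    simp only [hcoord, Finset.sum_add_distrib, Finset.sum_ite_eq', Finset.mem_univ, if_true, h1]
    ring

lemma ae_cfK_mem_stdSimplex {N : ℕ} {x : Fin N → ℝ} (hx : x ∈ stdSimplex ℝ (Fin N)) :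
    ∀ᵐ y ∂(cfK N x), y ∈ stdSimplex ℝ (Fin N) := by
  have hmeas : MeasurableSet (stdSimplex ℝ (Fin N))ᶜ :=
    (isClosed_stdSimplex ℝ (Fin N)).measurableSet.compl
  change cfK N x (stdSimplex ℝ (Fin N))ᶜ = 0
  rw [← lintegral_indicator_one hmeas, lintegral_cfK N x (measurable_one.indicator hmeas)]
  refine mul_eq_zero_of_right _ (Finset.sum_eq_zero fun p hp => ?_)
  rw [setLIntegral_congr_fun (g := 0) measurableSet_Icc]
  · simp
  · intro u hu
    simp [cfT_mem_stdSimplex (Finset.mem_filter.1 hp).2 hu hx]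

lemma hitProb_le_one {α : Type*} [MeasurableSpace α] {κ : α → Measure α}
    (hκ : ∀ x, IsProbabilityMeasure (κ x)) (B : Set α) (m : ℕ) (x : α) : hitProb κ B m x ≤ 1 := by
  induction m generalizing x with
  | zero => simp [hitProb]
  | succ m ih =>
    have := hκ x
    rw [hitProb]
    refine (lintegral_mono (g := fun _ => 1) fun y => ?_).trans (by simp)
    by_cases hy : y ∈ B
    · simp [hy]
    · simpa [hy] using ih y

lemma measurable_hitProb {α : Type*} [MeasurableSpace α] {κ : α → Measure α}
    (hκ : ∀ f : α → ℝ≥0∞, Measurable f → Measurable fun x => ∫⁻ y, f y ∂(κ x))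
    {B : Set α} (hB : MeasurableSet B) (m : ℕ) : Measurable (hitProb κ B m) := by
  induction m with
  | zero => exact measurable_const
  | succ m ih =>
    exact hκ _ ((measurable_const.indicator hB).add (ih.indicator hB.compl))

/-- One-step recursion for the survival probability `P_x(τ_B > m)`. -/
lemma one_sub_hitProb_succ {α : Type*} [MeasurableSpace α] {κ : α → Measure α}
    (hκ : ∀ x, IsProbabilityMeasure (κ x))
    (hmeas : ∀ f : α → ℝ≥0∞, Measurable f → Measurable fun x => ∫⁻ y, f y ∂(κ x))
    {B : Set α} (hB : MeasurableSet B) (m : ℕ) (x : α) :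
    1 - hitProb κ B (m + 1) x = ∫⁻ y, Bᶜ.indicator (fun y => 1 - hitProb κ B m y) y ∂(κ x) := by
  have := hκ x
  have hm := measurable_hitProb hmeas hB m
  have hW : Measurable fun y => B.indicator (fun _ => (1 : ℝ≥0∞)) y +
      Bᶜ.indicator (hitProb κ B m) y :=
    (measurable_const.indicator hB).add (hm.indicator hB.compl)
  have hle := hitProb_le_one hκ B (m + 1) x
  rw [hitProb] at hle ⊢
  nth_rw 1 [← measure_univ (μ := κ x), ← lintegral_one]
  rw [← lintegral_sub hW
    (ne_top_of_le_ne_top ENNReal.one_ne_top hle)]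
  · refine lintegral_congr fun y => ?_
    by_cases hy : y ∈ B <;> simp [hy]
  · refine Eventually.of_forall fun y => ?_
    by_cases hy : y ∈ B
    · simp [hy]
    · simpa [hy] using hitProb_le_one hκ B m y

/-- If the chain stays in `D` and hits `B` within `m` steps with probability at least `ρ` from
every point of `D`, then surviving `m` more steps costs a factor `1 - ρ`. -/
lemma one_sub_hitProb_add_le {α : Type*} [MeasurableSpace α] {κ : α → Measure α}
    (hκ : ∀ x, IsProbabilityMeasure (κ x))
    (hmeas : ∀ f : α → ℝ≥0∞, Measurable f → Measurable fun x => ∫⁻ y, f y ∂(κ x))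
    {B : Set α} (hB : MeasurableSet B) {D : Set α} (hD : ∀ x ∈ D, ∀ᵐ y ∂(κ x), y ∈ D)
    {ρ : ℝ≥0∞} {m : ℕ} (hρ : ∀ x ∈ D, ρ ≤ hitProb κ B m x) (k : ℕ) {x : α} (hx : x ∈ D) :
    1 - hitProb κ B (k + m) x ≤ (1 - ρ) * (1 - hitProb κ B k x) := by
  induction k generalizing x with
  | zero => simpa [hitProb] using tsub_le_tsub_left (hρ x hx) 1
  | succ k ih =>
    have hmeas_surv : Measurable fun y => 1 - hitProb κ B k y :=
      measurable_const.sub (measurable_hitProb hmeas hB k)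
    rw [Nat.add_right_comm, one_sub_hitProb_succ hκ hmeas hB, one_sub_hitProb_succ hκ hmeas hB,
      ← lintegral_const_mul _ (hmeas_surv.indicator hB.compl)]
    refine lintegral_mono_ae ?_
    filter_upwards [hD x hx] with y hy
    by_cases hyB : y ∈ B
    · simp [hyB]
    · simpa [hyB] using ih hy

lemma one_sub_hitProb_mul_le_pow {α : Type*} [MeasurableSpace α] {κ : α → Measure α}
    (hκ : ∀ x, IsProbabilityMeasure (κ x))
    (hmeas : ∀ f : α → ℝ≥0∞, Measurable f → Measurable fun x => ∫⁻ y, f y ∂(κ x))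
    {B : Set α} (hB : MeasurableSet B) {D : Set α} (hD : ∀ x ∈ D, ∀ᵐ y ∂(κ x), y ∈ D)
    {ρ : ℝ≥0∞} {m : ℕ} (hρ : ∀ x ∈ D, ρ ≤ hitProb κ B m x) (M : ℕ) {x : α} (hx : x ∈ D) :
    1 - hitProb κ B (m * M) x ≤ (1 - ρ) ^ M := by
  induction M with
  | zero => simp
  | succ M ih =>
    rw [Nat.mul_succ, pow_succ']
    exact (one_sub_hitProb_add_le hκ hmeas hB hD hρ (m * M) hx).trans (by gcongr)

/-- The simplex in the coordinates that omit the coordinate of index `0`. -/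
def cornerSimplex (n : ℕ) : Set (Fin n → ℝ) := {z | (∀ i, 0 ≤ z i) ∧ ∑ i, z i ≤ 1}

/-- The affine chart of the hyperplane `∑ x_i = 1` that omits the coordinate of index `0`. -/
def simplexChart (n : ℕ) (z : Fin n → ℝ) : Fin (n + 1) → ℝ := Fin.cons (1 - ∑ i, z i) z

lemma measurableSet_cornerSimplex (n : ℕ) : MeasurableSet (cornerSimplex n) := by
  have h : cornerSimplex n = (⋂ i, {z | 0 ≤ z i}) ∩ {z | ∑ i, z i ≤ 1} := by
    ext
    simp [cornerSimplex]
  rw [h]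
  refine IsClosed.measurableSet (IsClosed.inter (isClosed_iInter fun i => ?_) ?_)
  · exact isClosed_le continuous_const (continuous_apply i)
  · exact isClosed_le (by fun_prop) continuous_const

lemma simplexChart_tail {n : ℕ} {x : Fin (n + 1) → ℝ} (hx : x ∈ stdSimplex ℝ (Fin (n + 1))) :
    simplexChart n (Fin.tail x) = x := by
  have h := hx.2
  rw [Fin.sum_univ_succ] at h
  have h0 : 1 - ∑ i, Fin.tail x i = x 0 := by
    simp only [Fin.tail]
    linarith
  rw [simplexChart, h0, Fin.cons_self_tail]

lemma tail_mem_cornerSimplex {n : ℕ} {x : Fin (n + 1) → ℝ}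
    (hx : x ∈ stdSimplex ℝ (Fin (n + 1))) : Fin.tail x ∈ cornerSimplex n := by
  refine ⟨fun i => hx.1 _, ?_⟩
  have h := hx.2
  rw [Fin.sum_univ_succ] at h
  have := hx.1 0
  simp only [Fin.tail]
  linarith

lemma lipschitzWith_simplexChart (n : ℕ) : LipschitzWith (n + 1) (simplexChart n) := by
  refine LipschitzWith.of_dist_le_mul fun z w => ?_
  refine (dist_pi_le_iff (by positivity)).2 fun k => ?_
  push_cast
  refine Fin.cases ?_ (fun i => ?_) k
  · simp only [simplexChart, Fin.cons_zero, Real.dist_eq]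
    have h : 1 - ∑ i, z i - (1 - ∑ i, w i) = ∑ i, (w i - z i) := by
      rw [Finset.sum_sub_distrib]
      ring
    rw [h]
    refine (Finset.abs_sum_le_sum_abs _ _).trans ?_
    have hb : ∀ i ∈ Finset.univ, |w i - z i| ≤ dist z w := fun i _ => by
      rw [← Real.dist_eq, dist_comm]
      exact dist_le_pi_dist z w i
    refine (Finset.sum_le_card_nsmul _ _ _ hb).trans ?_
    have := dist_nonneg (x := z) (y := w)
    simp only [Finset.card_univ, Fintype.card_fin, nsmul_eq_mul]
    linarith
  · simp only [simplexChart, Fin.cons_succ]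
    refine (dist_le_pi_dist z w i).trans ?_
    have := dist_nonneg (x := z) (y := w)
    nlinarith [Nat.cast_nonneg (α := ℝ) n]

/-- In the chart, the step that mixes coordinate `i` with the omitted one changes only `i`. -/
lemma cfT_simplexChart {n : ℕ} (i : Fin n) (u : ℝ) (z : Fin n → ℝ) :
    cfT (n + 1) i.succ 0 u (simplexChart n z) =
      simplexChart n (Function.update z i (u * (z i + (1 - ∑ k, z k)))) := by
  have hsum : ∀ t, ∑ k, Function.update z i t k = ∑ k, z k + (t - z i) := fun t => by
    rw [Finset.sum_update_of_mem (Finset.mem_univ i), Finset.sdiff_singleton_eq_erase,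
      ← Finset.add_sum_erase Finset.univ z (Finset.mem_univ i)]
    ring
  ext k
  refine Fin.cases ?_ (fun l => ?_) k
  · simp only [cfT, simplexChart, Function.update_self, Fin.cons_zero, Fin.cons_succ, hsum]
    ring
  · by_cases hl : l = i
    · subst hl
      simp [cfT, simplexChart]
    · simp [cfT, simplexChart, hl]

lemma update_mem_cornerSimplex {n : ℕ} {z : Fin n → ℝ} (hz : z ∈ cornerSimplex n) (i : Fin n)
    {u : ℝ} (hu : u ∈ Set.Icc (0 : ℝ) 1) :
    Function.update z i (u * (z i + (1 - ∑ k, z k))) ∈ cornerSimplex n := by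
  have hs : 0 ≤ z i + (1 - ∑ k, z k) := by linarith [hz.1 i, hz.2]
  refine ⟨fun k => ?_, ?_⟩
  · rw [Function.update_apply]
    split_ifs
    · exact mul_nonneg hu.1 hs
    · exact hz.1 k
  · rw [Finset.sum_update_of_mem (Finset.mem_univ i), Finset.sdiff_singleton_eq_erase]
    have := Finset.add_sum_erase Finset.univ z (Finset.mem_univ i)
    nlinarith [mul_nonneg (sub_nonneg.2 hu.2) hs]

lemma setLIntegral_Icc_le_comp_mul {s : ℝ} (hs0 : 0 ≤ s) (hs1 : s ≤ 1) {h : ℝ → ℝ≥0∞}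
    (hh : Measurable h) :
    ∫⁻ t in Set.Icc 0 s, h t ≤ ∫⁻ u in Set.Icc (0 : ℝ) 1, h (u * s) := by
  rcases hs0.eq_or_lt with rfl | hpos
  · simp
  rw [← lintegral_indicator measurableSet_Icc, ← lintegral_indicator measurableSet_Icc,
    ← Real.smul_map_volume_mul_right hpos.ne', lintegral_smul_measure, smul_eq_mul,
    lintegral_map (hh.indicator measurableSet_Icc) (measurable_mul_const s)]
  have hle : ENNReal.ofReal |s| ≤ 1 := by
    rw [abs_of_pos hpos]
    exact ENNReal.ofReal_le_one.2 hs1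
  refine (mul_le_of_le_one_left' hle).trans ?_
  rw [Real.smul_map_volume_mul_right hpos.ne']
  refine lintegral_mono fun u => ?_
  by_cases hu : u ∈ Set.Icc (0 : ℝ) 1
  · rw [Set.indicator_of_mem hu]
    exact Set.indicator_le_self _ _ _
  · rw [Set.indicator_of_notMem hu, Set.indicator_of_notMem]
    intro hmem
    refine hu ⟨?_, ?_⟩
    · exact nonneg_of_mul_nonneg_left hmem.1 hpos
    · exact le_of_mul_le_mul_right (by linarith [hmem.2]) hpos

/-- A point of the corner simplex that agrees with `x` off a nonempty `S` can have one of its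
coordinates in `S` produced from `x` in one step. -/
lemma exists_le_add_slack {n : ℕ} {x y : Fin n → ℝ} (hx : x ∈ cornerSimplex n)
    (hy : y ∈ cornerSimplex n) {S : Finset (Fin n)} (hS : S.Nonempty)
    (hxy : ∀ i ∉ S, y i = x i) : ∃ i ∈ S, y i ≤ x i + (1 - ∑ k, x k) := by
  by_contra! hcon
  obtain ⟨i, hi⟩ := hS
  have hslack : 0 ≤ 1 - ∑ k, x k := by linarith [hx.2]
  have hle : ∀ k, x k + (if k = i then 1 - ∑ l, x l else 0) ≤ y k := fun k => by
    by_cases hk : k ∈ S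
    · have := hcon k hk
      split_ifs <;> linarith
    · have hki : k ≠ i := fun h => hk (h ▸ hi)
      simp [hki, hxy k hk]
  have hlt := Finset.sum_lt_sum (s := Finset.univ) (fun k _ => hle k)
    ⟨i, Finset.mem_univ i, by simpa using hcon i hi⟩
  rw [Finset.sum_add_distrib] at hlt
  simp only [Finset.sum_ite_eq', Finset.mem_univ, if_true] at hlt
  linarith [hy.2]

/-- The marginal integral over `S` is covered by the parts where a single coordinate `i ∈ S`
is reachable from `x` in one step. -/
lemma lmarginal_le_sum_setLIntegral {n : ℕ} {G : (Fin n → ℝ) → ℝ≥0∞} (hG : Measurable G)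
    (hsupp : ∀ y ∉ cornerSimplex n, G y = 0) {S : Finset (Fin n)} (hS : S.Nonempty)
    {x : Fin n → ℝ} (hx : x ∈ cornerSimplex n) :
    (∫⋯∫⁻_S, G ∂fun _ => volume) x ≤ ∑ i ∈ S, ∫⁻ t in Set.Icc 0 (x i + (1 - ∑ k, x k)),
      (∫⋯∫⁻_S.erase i, G ∂fun _ => volume) (Function.update x i t) := by
  set E : Fin n → Set (Fin n → ℝ) := fun i => {y | y i ∈ Set.Icc 0 (x i + (1 - ∑ k, x k))}
    with hE
  have hEmeas : ∀ i, MeasurableSet (E i) := fun i => measurable_pi_apply i measurableSet_Icc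
  have hGmeas : ∀ i, Measurable ((E i).indicator G) := fun i => hG.indicator (hEmeas i)
  have hcover : (∫⋯∫⁻_S, G ∂fun _ => volume) x ≤
      ∑ i ∈ S, (∫⋯∫⁻_S, (E i).indicator G ∂fun _ => volume) x := by
    have hcomp : ∀ i, Measurable fun y : S → ℝ =>
        (E i).indicator G (Function.updateFinset x S y) :=
      fun i => (hGmeas i).comp measurable_updateFinset
    simp only [lmarginal]
    rw [← lintegral_finsetSum _ fun i _ => hcomp i]
    refine lintegral_mono fun y => ?_
    set w := Function.updateFinset x S y with hw
    by_cases hwD : w ∈ cornerSimplex n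
    · obtain ⟨i, hi, hle⟩ := exists_le_add_slack hx hwD hS fun i hi => by
        simp [hw, Function.updateFinset, hi]
      have hmem : w ∈ E i := ⟨hwD.1 i, hle⟩
      calc G w = (E i).indicator G w := (Set.indicator_of_mem hmem G).symm
        _ ≤ _ := Finset.single_le_sum (f := fun i => (E i).indicator G w)
          (fun _ _ => zero_le) hi
    · simp [hsupp w hwD]
  refine hcover.trans (Finset.sum_le_sum fun i hi => ?_)
  rw [lmarginal_erase _ (hGmeas i) hi, ← lintegral_indicator measurableSet_Icc]
  refine lintegral_mono fun t => ?_
  have hcoord : ∀ y, Function.updateFinset (Function.update x i t) (S.erase i) y i = t := by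
    intro y
    simp [Function.updateFinset]
  by_cases ht : t ∈ Set.Icc 0 (x i + (1 - ∑ k, x k))
  · rw [Set.indicator_of_mem ht]
    exact lmarginal_mono (fun y => Set.indicator_le_self _ _ _) _
  · rw [Set.indicator_of_notMem ht, lmarginal, nonpos_iff_eq_zero]
    refine (lintegral_congr fun y => Set.indicator_of_notMem ?_ G).trans lintegral_zero
    simpa only [hE, Set.mem_ofPred_eq, hcoord y] using ht

/-- A minorization by marginal integrals over `S.erase i` is propagated by one step of the
chain to a minorization by the marginal integral over `S`. -/
lemma mul_lmarginal_le_lintegral_cfK {n : ℕ} {G : (Fin n → ℝ) → ℝ≥0∞} (hG : Measurable G)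
    (hsupp : ∀ y ∉ cornerSimplex n, G y = 0) {S : Finset (Fin n)} (hS : S.Nonempty)
    {F : (Fin (n + 1) → ℝ) → ℝ≥0∞} (hF : Measurable F) {b : ℝ≥0∞}
    (hb : ∀ i ∈ S, ∀ z ∈ cornerSimplex n,
      b * (∫⋯∫⁻_S.erase i, G ∂fun _ => volume) z ≤ F (simplexChart n z))
    {x : Fin n → ℝ} (hx : x ∈ cornerSimplex n) :
    (((n + 1 : ℕ) : ℝ≥0∞) * (((n + 1 : ℕ) : ℝ≥0∞) - 1))⁻¹ * b *
      (∫⋯∫⁻_S, G ∂fun _ => volume) x ≤ ∫⁻ y, F y ∂(cfK (n + 1) (simplexChart n x)) := by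
  rw [lintegral_cfK _ _ hF, mul_assoc]
  gcongr
  let e : Fin n ↪ Fin (n + 1) × Fin (n + 1) :=
    ⟨fun i => (i.succ, 0), fun i j h => Fin.succ_injective n (Prod.ext_iff.1 h).1⟩
  have hsub : S.map e ⊆
      Finset.univ.filter (fun p : Fin (n + 1) × Fin (n + 1) => p.1 ≠ p.2) := by
    intro p hp
    obtain ⟨i, -, rfl⟩ := Finset.mem_map.1 hp
    exact Finset.mem_filter.2 ⟨Finset.mem_univ _, Fin.succ_ne_zero i⟩
  refine le_trans ?_ (Finset.sum_le_sum_of_subset hsub)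
  rw [Finset.sum_map]
  refine (mul_le_mul_right (lmarginal_le_sum_setLIntegral hG hsupp hS hx) b).trans ?_
  rw [Finset.mul_sum]
  refine Finset.sum_le_sum fun i hi => ?_
  have hmarg : Measurable fun t =>
      (∫⋯∫⁻_S.erase i, G ∂fun _ => volume) (Function.update x i t) :=
    (hG.lmarginal _).comp (measurable_update x)
  have hslack_le : x i + (1 - ∑ k, x k) ≤ 1 := by
    linarith [Finset.single_le_sum (f := x) (fun k _ => hx.1 k) (Finset.mem_univ i)]
  rw [← lintegral_const_mul _ hmarg]
  refine (setLIntegral_Icc_le_comp_mul (by linarith [hx.1 i, hx.2]) hslack_le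
    (hmarg.const_mul b)).trans ?_
  refine setLIntegral_mono_ae' measurableSet_Icc (Eventually.of_forall fun u hu => ?_)
  change _ ≤ F (cfT (n + 1) i.succ 0 u (simplexChart n x))
  rw [cfT_simplexChart]
  exact hb i hi _ (update_mem_cornerSimplex hx i hu)

/-- Minorization: `P_x(τ_A ≤ |S|)` dominates the Lebesgue measure of the points of `A` that
agree with `x` off `S`, up to a constant. -/
lemma pow_mul_lmarginal_le_hitProb {n : ℕ} (hn : 1 ≤ n) {A : Set (Fin (n + 1) → ℝ)}
    (hA : MeasurableSet A) {S : Finset (Fin n)} (hS : S.Nonempty) {x : Fin n → ℝ}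
    (hx : x ∈ cornerSimplex n) :
    (((n + 1 : ℕ) : ℝ≥0∞) * (((n + 1 : ℕ) : ℝ≥0∞) - 1))⁻¹ ^ S.card *
      (∫⋯∫⁻_S, (cornerSimplex n ∩ simplexChart n ⁻¹' A).indicator 1 ∂fun _ => volume) x ≤
        hitProb (cfK (n + 1)) A S.card (simplexChart n x) := by
  have hprob := isProbabilityMeasure_cfK (N := n + 1) (by omega)
  have hchart : Measurable (simplexChart n) := (lipschitzWith_simplexChart n).continuous.measurable
  have hG : Measurable ((cornerSimplex n ∩ simplexChart n ⁻¹' A).indicator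
      (1 : (Fin n → ℝ) → ℝ≥0∞)) :=
    measurable_one.indicator ((measurableSet_cornerSimplex n).inter (hchart hA))
  have hmeas := measurable_hitProb (fun _ => measurable_lintegral_cfK (n + 1)) hA
  obtain ⟨m, hm⟩ : ∃ m, S.card = m + 1 := ⟨S.card - 1, by have := hS.card_pos; omega⟩
  rw [hm]
  induction m generalizing S x with
  | zero =>
    rw [pow_succ', hitProb]
    refine mul_lmarginal_le_lintegral_cfK hG (fun y hy => by simp [hy]) hS
      ((measurable_const.indicator hA).add ((hmeas 0).indicator hA.compl)) ?_ hx
    intro i hi z hz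
    have hempty : S.erase i = ∅ := by
      rw [← Finset.card_eq_zero, Finset.card_erase_of_mem hi, hm]
    by_cases hzA : simplexChart n z ∈ A <;> simp [hempty, hzA]
    exact Set.indicator_le_self _ _ _
  | succ m ih =>
    rw [pow_succ', hitProb]
    refine mul_lmarginal_le_lintegral_cfK hG (fun y hy => by simp [hy]) hS
      ((measurable_const.indicator hA).add ((hmeas (m + 1)).indicator hA.compl)) ?_ hx
    intro i hi z hz
    have hcard : (S.erase i).card = m + 1 := by
      rw [Finset.card_erase_of_mem hi, hm]
      rfl
    refine (ih (Finset.card_pos.1 (by omega)) hz hcard).trans ?_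
    by_cases hzA : simplexChart n z ∈ A
    · simpa [hzA] using hitProb_le_one hprob A (m + 1) (simplexChart n z)
    · simp [hzA]

lemma volume_chart_preimage_ne_zero {n : ℕ} {A : Set (Fin (n + 1) → ℝ)} (hA : MeasurableSet A)
    (hpos : 0 < uniformSimplex (n + 1) A) :
    volume (cornerSimplex n ∩ simplexChart n ⁻¹' A) ≠ 0 := by
  intro h0
  have hdim : (((n + 1 : ℕ) : ℝ) - 1) = n := by
    push_cast
    ring
  have hvol : (μH[(n : ℝ)] : Measure (Fin n → ℝ)) = volume := by
    simpa using hausdorffMeasure_pi_real (ι := Fin n)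
  refine hpos.ne' ?_
  rw [uniformSimplex, hdim, Measure.smul_apply, Measure.restrict_apply hA]
  have hsub : A ∩ stdSimplex ℝ (Fin (n + 1)) ⊆
      simplexChart n '' (cornerSimplex n ∩ simplexChart n ⁻¹' A) := fun x hx =>
    ⟨Fin.tail x, ⟨tail_mem_cornerSimplex hx.2, by
      simpa only [Set.mem_preimage, simplexChart_tail hx.2] using hx.1⟩, simplexChart_tail hx.2⟩
  have hle := (measure_mono hsub).trans
    ((lipschitzWith_simplexChart n).hausdorffMeasure_image_le (d := n) (by positivity) _)
  rw [hvol, h0, mul_zero, nonpos_iff_eq_zero] at hle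
  rw [hle, smul_zero]

/-- For every Borel set `A ⊆ Δ_{N-1}` of positive uniform measure there is `ρ_A > 0` such
that, uniformly in the starting point `x ∈ Δ_{N-1}`, the first hitting time of `A` by the
coagulation–fragmentation chain has geometric tails:
`P_x(τ_A > (N-1)M) ≤ (1-ρ_A)^M` for all `M ∈ ℕ`. -/
theorem cfK_geometric_tails (N : ℕ) (hN : 2 ≤ N) (A : Set (Fin N → ℝ))
    (hA : MeasurableSet A) (hApos : 0 < uniformSimplex N A) :
    ∃ ρ : ℝ≥0∞, 0 < ρ ∧ ρ ≤ 1 ∧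
      ∀ x ∈ stdSimplex ℝ (Fin N), ∀ M : ℕ,
        1 - hitProb (cfK N) A ((N - 1) * M) x ≤ (1 - ρ) ^ M := by
  obtain ⟨n, rfl⟩ : ∃ n, N = n + 1 := ⟨N - 1, by omega⟩
  have hn : 1 ≤ n := by omega
  have : Nonempty (Fin n) := ⟨⟨0, by omega⟩⟩
  have hprob := isProbabilityMeasure_cfK hN
  have hchart : Measurable (simplexChart n) := (lipschitzWith_simplexChart n).continuous.measurable
  set c : ℝ≥0∞ := (((n + 1 : ℕ) : ℝ≥0∞) * (((n + 1 : ℕ) : ℝ≥0∞) - 1))⁻¹ with hc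
  have hc0 : c ≠ 0 := ENNReal.inv_ne_zero.2 (ENNReal.mul_ne_top (ENNReal.natCast_ne_top _)
    (ne_top_of_le_ne_top (ENNReal.natCast_ne_top _) tsub_le_self))
  set ρ : ℝ≥0∞ := c ^ n * volume (cornerSimplex n ∩ simplexChart n ⁻¹' A) with hρ
  have hhit : ∀ x ∈ stdSimplex ℝ (Fin (n + 1)), ρ ≤ hitProb (cfK (n + 1)) A n x := by
    intro x hx
    have h := pow_mul_lmarginal_le_hitProb hn hA Finset.univ_nonempty (tail_mem_cornerSimplex hx)
    rwa [simplexChart_tail hx, lmarginal_univ, Finset.card_univ, Fintype.card_fin, ← hc,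
      ← volume_pi, lintegral_indicator_one
        ((measurableSet_cornerSimplex n).inter (hchart hA))] at h
  refine ⟨ρ, pos_iff_ne_zero.2 (mul_ne_zero (pow_ne_zero n hc0)
    (volume_chart_preimage_ne_zero hA hApos)), ?_, fun x hx M => ?_⟩
  · exact (hhit _ (single_mem_stdSimplex ℝ 0)).trans (hitProb_le_one hprob A n _)
  · exact one_sub_hitProb_mul_le_pow hprob (fun _ => measurable_lintegral_cfK (n + 1)) hA
      (fun _ => ae_cfK_mem_stdSimplex) hhit M hx
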